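/- Let p be an odd prime, n a positive integer, and K = 𝔽_{p^n}. For every function F : K → K, every α ∈ K, and every x ∈ K, the (p−1)-st order derivative in the directions α, 2α, …, (p−1)α satisfies Δ_{α,2α,…,(p−1)α} F(x) = −Σ_{ι=0}^{p−1} F(x + ι·α), where i·α denotes the natural number i acting on α. -/

import Mathlib

/-- Discrete derivative of `F` in direction `α`: `Δ_α F x = F (x + α) - F x`. -/
def delta {A B : Type*} [Add A] [Sub B] (α : A) (F : A → B) : A → B :=
  fun x => F (x + α) - F x

/-- Higher-order discrete derivative along a list of directions:
`Δ_{α₁,…,α_d} F = Δ_{α₁} (Δ_{α₂,…,α_d} F)`. -/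
def deltaList {A B : Type*} [Add A] [Sub B] (l : List A) (F : A → B) : A → B :=
  l.foldr delta F

open Polynomial in
/-- Modulo `X ^ p - 1` in characteristic `p`, `∏ (X ^ i - 1)` over `0 < i < p` is minus the
geometric sum. -/
theorem X_pow_sub_one_dvd_prod_add_geom_sum (R : Type*) [CommRing R] [IsDomain R] (p : ℕ)
    [Fact p.Prime] [CharP R p] :
    (X ^ p - 1 : R[X]) ∣
      ∏ i ∈ Finset.range (p - 1), (X ^ (i + 1) - 1) + ∑ i ∈ Finset.range p, X ^ i := by
  have hgeom : (X - 1 : R[X]) ^ (p - 1) = ∑ i ∈ Finset.range p, X ^ i := by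
    have hX : (X - 1 : R[X]) ≠ 0 := by simpa using X_sub_C_ne_zero (1 : R)
    apply mul_right_cancel₀ hX
    rw [geom_sum_mul, pow_sub_one_mul (Fact.out : p.Prime).ne_zero, sub_pow_char, one_pow]
  set q : R[X] := ∏ i ∈ Finset.range (p - 1), ∑ j ∈ Finset.range (i + 1), X ^ j
  have hprod : ∏ i ∈ Finset.range (p - 1), (X ^ (i + 1) - 1 : R[X])
      = q * ∑ i ∈ Finset.range p, X ^ i := by
    simp_rw [← geom_sum_mul, Finset.prod_mul_distrib, Finset.prod_const, Finset.card_range]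
    rw [hgeom]
  have heval : q.eval 1 = -1 := by
    have hfact : q.eval 1 = ((p - 1).factorial : R) := by
      simp [q, eval_prod, eval_finsetSum, ← Finset.prod_range_add_one_eq_factorial]
    have hwilson := congrArg (ZMod.castHom dvd_rfl R) (ZMod.wilsons_lemma p)
    rw [map_natCast, map_neg, map_one] at hwilson
    rw [hfact, hwilson]
  have hdvd : (X - 1 : R[X]) ∣ q + 1 := by
    simpa [heval] using X_sub_C_dvd_sub_C_eval (a := (1 : R)) (p := q)
  rw [hprod, ← add_one_mul, ← mul_geom_sum]
  exact mul_dvd_mul_right hdvd _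

theorem funLeft_add_right_pow_apply {A R : Type*} [AddCommMonoid A] [CommRing R] (α : A) (i : ℕ)
    (F : A → R) (x : A) :
    (LinearMap.funLeft R R (· + α) ^ i) F x = F (x + i • α) := by
  induction i generalizing x with
  | zero => simp
  | succ i ih => rw [pow_succ', Module.End.mul_apply, LinearMap.funLeft_apply, ih, succ_nsmul',
      add_assoc]

open Polynomial in
/-- Iterated derivatives along multiples of `α` are polynomials in the translation by `α`. -/
theorem deltaList_map_nsmul {A R : Type*} [AddCommMonoid A] [CommRing R] (α : A) (l : List ℕ)
    (F : A → R) :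
    deltaList (l.map (· • α)) F
      = aeval (LinearMap.funLeft R R (· + α)) (l.map fun i => (X ^ i - 1 : R[X])).prod F := by
  induction l with
  | nil => simp [deltaList]
  | cons i l ih =>
    rw [List.map_cons, List.map_cons, List.prod_cons, map_mul, Module.End.mul_apply, ← ih]
    funext x
    simp [deltaList, delta, funLeft_add_right_pow_apply]

open Polynomial in
theorem deltaList_range_nsmul {A R : Type*} [AddCommMonoid A] [CommRing R] [IsDomain R] (p : ℕ)
    [Fact p.Prime] [CharP R p] {α : A} (hα : p • α = 0) (F : A → R) (x : A) :
    deltaList ((List.range (p - 1)).map fun i => (i + 1) • α) F x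
      = -∑ i ∈ Finset.range p, F (x + i • α) := by
  have hperiod : aeval (LinearMap.funLeft R R (· + α)) (X ^ p - 1 : R[X]) = 0 := by
    ext1 G
    funext y
    simp [funLeft_add_right_pow_apply, hα]
  obtain ⟨r, hr⟩ := X_pow_sub_one_dvd_prod_add_geom_sum R p
  have hdelta := deltaList_map_nsmul α ((List.range (p - 1)).map (· + 1)) F
  simp only [List.map_map, Function.comp_def] at hdelta
  rw [hdelta, ← List.prod_toFinset _ List.nodup_range, List.toFinset_range, eq_sub_of_add_eq hr,
    map_sub, map_mul, hperiod, zero_mul, zero_sub]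
  simp [funLeft_add_right_pow_apply]

theorem stmt_7 (p : ℕ) [Fact p.Prime] (hodd : p ≠ 2) (n : ℕ) (hn : 0 < n)
    (F : GaloisField p n → GaloisField p n) (α : GaloisField p n)
    (x : GaloisField p n) :
    deltaList ((List.range (p - 1)).map (fun i => (i + 1) • α)) F x
      = - ∑ ι ∈ Finset.range p, F (x + ι • α) := by
  exact deltaList_range_nsmul p (by simp) F x
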